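/- Let G be a finite simple graph and let Z ⊆ V(G) be a nonempty set of vertices such that the induced subgraph G[Z] is connected. Partition the connected components of G − Z into two parts arbitrarily, and let A and B denote the unions of the vertex sets of the components in the respective parts (so V(G) = A ∪ B ∪ Z and A, B, Z are pairwise disjoint). If R is a tour of G, then there exist a tour R_A of the induced subgraph G[A ∪ Z] and a tour R_B of the induced subgraph G[B ∪ Z] such that |R_A| + |R_B| ≤ |R| + 4·|Z|. -/

import Mathlib

open SimpleGraph

/-- The union of the vertex sets of a collection `X` of connected components of `G − Z`
(the subgraph of `G` induced on the complement of `Z`). -/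
def compUnion {V : Type*} (G : SimpleGraph V) (Z : Set V)
    (X : Set ((G.induce (Zᶜ : Set V)).ConnectedComponent)) : Set V :=
  {v | ∃ h : v ∈ (Zᶜ : Set V), (G.induce (Zᶜ : Set V)).connectedComponentMk ⟨v, h⟩ ∈ X}

/-- A tour of a graph is a closed walk visiting every vertex at least once. -/
def IsTour {V : Type*} {G : SimpleGraph V} {x : V} (R : G.Walk x x) : Prop :=
  ∀ v : V, v ∈ R.support

/-- `WalkFamily G P S m U` says that some finite family of walks of `G` inside `P`, all with both
ends in `S`, has total length at most `m` and together visits every vertex of `U`. -/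
inductive WalkFamily {V : Type*} (G : SimpleGraph V) (P S : Set V) : ℕ → Set V → Prop
  | nil {m : ℕ} : WalkFamily G P S m ∅
  | cons {m n : ℕ} {U W : Set V} {a b : V} (p : G.Walk a b) (ha : a ∈ S) (hb : b ∈ S)
      (hp : ∀ x ∈ p.support, x ∈ P) (hF : WalkFamily G P S n W) (hlen : p.length + n ≤ m)
      (hU : ∀ x ∈ U, x ∈ p.support ∨ x ∈ W) : WalkFamily G P S m U

section

variable {V : Type*} {G : SimpleGraph V}

theorem WalkFamily.subset {P S : Set V} {m : ℕ} {U : Set V} (h : WalkFamily G P S m U) :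
    U ⊆ P := by
  induction h with
  | nil => exact Set.empty_subset _
  | cons p ha hb hp hF hlen hU ih =>
    intro x hx
    exact (hU x hx).elim (hp x) (fun h => ih h)

theorem WalkFamily.eq_empty {P : Set V} {m : ℕ} {U : Set V} (h : WalkFamily G P ∅ m U) :
    U = ∅ := by
  cases h with
  | nil => rfl
  | cons p ha hb hp hF hlen hU => exact ha.elim

/-- Joining walks at a common end `v` turns a family with ends in `insert v S` into a family with
ends in `S` together with a single walk starting at `v`. -/
theorem WalkFamily.exists_walk_of_insert {P S : Set V} {v : V} (hv : v ∈ P) {m : ℕ} {U : Set V}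
    (h : WalkFamily G P (insert v S) m U) :
    ∃ (w : V) (p : G.Walk v w) (n : ℕ) (W : Set V), w ∈ insert v S ∧
      (∀ x ∈ p.support, x ∈ P) ∧ WalkFamily G P S n W ∧ p.length + n ≤ m ∧
      ∀ x ∈ U, x ∈ p.support ∨ x ∈ W := by
  induction h with
  | nil =>
    exact ⟨v, .nil, 0, ∅, Set.mem_insert _ _, by simpa using hv, .nil, by simp, by simp⟩
  | @cons m k U W a b q ha hb hq hF hlen hU ih =>
    obtain ⟨w, p, n, W', hw, hp, hF', hn, hW⟩ := ih
    have starting : ∀ (b : V) (q : G.Walk v b), b ∈ insert v S → (∀ x ∈ q.support, x ∈ P) →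
        q.length + k ≤ m → (∀ x ∈ U, x ∈ q.support ∨ x ∈ W) →
        ∃ (w : V) (p : G.Walk v w) (n : ℕ) (W : Set V), w ∈ insert v S ∧
          (∀ x ∈ p.support, x ∈ P) ∧ WalkFamily G P S n W ∧ p.length + n ≤ m ∧
          ∀ x ∈ U, x ∈ p.support ∨ x ∈ W := by
      intro b q hb hq hlen hU
      by_cases hwv : w = v
      · subst hwv
        refine ⟨b, p.append q, n, W', hb, ?_, hF', ?_, ?_⟩
        · intro x hx
          rw [Walk.mem_support_append_iff] at hx
          exact hx.elim (hp x) (hq x)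
        · rw [Walk.length_append]; omega
        · intro x hx
          rw [Walk.mem_support_append_iff]
          have := hU x hx
          have := hW x
          tauto
      · by_cases hbv : b = v
        · subst hbv
          refine ⟨w, q.append p, n, W', hw, ?_, hF', ?_, ?_⟩
          · intro x hx
            rw [Walk.mem_support_append_iff] at hx
            exact hx.elim (hq x) (hp x)
          · rw [Walk.length_append]; omega
          · intro x hx
            rw [Walk.mem_support_append_iff]
            have := hU x hx
            have := hW x
            tauto
        · refine ⟨v, .nil, m, U, Set.mem_insert _ _, by simpa using hv, ?_, by simp, fun _ => .inr⟩
          refine .cons (q.reverse.append p) (hb.resolve_left hbv) (hw.resolve_left hwv) ?_ hF' ?_ ?_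
          · intro x hx
            rw [Walk.mem_support_append_iff, Walk.support_reverse, List.mem_reverse] at hx
            exact hx.elim (hq x) (hp x)
          · rw [Walk.length_append, Walk.length_reverse]; omega
          · intro x hx
            rw [Walk.mem_support_append_iff, Walk.support_reverse, List.mem_reverse]
            have := hU x hx
            have := hW x
            tauto
    by_cases hav : a = v
    · subst hav
      exact starting b q hb hq hlen hU
    · by_cases hbv : b = v
      · subst hbv
        exact starting a q.reverse ha (by simpa using hq) (by simpa using hlen) (by simpa using hU)
      · refine ⟨w, p, q.length + n, {x | x ∈ q.support ∨ x ∈ W'}, hw, hp,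
          .cons q (ha.resolve_left hav) (hb.resolve_left hbv) hq hF' le_rfl fun x hx => hx,
          by omega, ?_⟩
        intro x hx
        have := hU x hx
        have := hW x
        simp only [Set.mem_ofPred_eq]
        tauto

/-- A finite set inducing a connected subgraph can be built from a single vertex by successively
adding neighbours. -/
theorem induction_of_connected_induce {Z : Set V} (hfin : Z.Finite) (hZ : Z.Nonempty)
    (hconn : (G.induce Z).Connected) {motive : Set V → Prop}
    (singleton : ∀ v ∈ Z, motive {v})
    (insert : ∀ (S : Set V) (u v : V), S ⊆ Z → u ∈ S → v ∈ Z → v ∉ S → G.Adj u v → motive S →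
      motive (insert v S)) : motive Z := by
  suffices h : ∀ k < Z.ncard, ∃ S ⊆ Z, S.ncard = k + 1 ∧ motive S by
    have hpos := (Set.ncard_pos hfin).2 hZ
    obtain ⟨S, hSZ, hcard, hS⟩ := h (Z.ncard - 1) (by omega)
    rwa [Set.eq_of_subset_of_ncard_le hSZ (by omega) hfin] at hS
  intro k
  induction k with
  | zero =>
    intro _
    obtain ⟨v, hv⟩ := hZ
    exact ⟨{v}, by simpa using hv, by simp, singleton v hv⟩
  | succ k ih =>
    intro hk
    obtain ⟨S, hSZ, hcard, hS⟩ := ih (by omega)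
    obtain ⟨s, hs⟩ : S.Nonempty := Set.nonempty_of_ncard_ne_zero (by omega)
    obtain ⟨t, htZ, htS⟩ : ∃ t ∈ Z, t ∉ S := Set.exists_mem_notMem_of_ncard_lt_ncard
      (by omega) (hfin.subset hSZ)
    obtain ⟨p⟩ := hconn.preconnected ⟨s, hSZ hs⟩ ⟨t, htZ⟩
    obtain ⟨d, -, hd1, hd2⟩ := p.exists_boundary_dart {x | x.1 ∈ S} hs htS
    refine ⟨Insert.insert d.snd.1 S, Set.insert_subset d.snd.2 hSZ, ?_,
      insert S d.fst.1 d.snd.1 hSZ hd1 d.snd.2 hd2 d.adj hS⟩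
    rw [Set.ncard_insert_of_notMem (a := d.snd.1) (s := S) hd2 (hfin.subset hSZ), hcard]

/-- A family of walks with ends in a connected set `Z` can be joined to a closed walk visiting `Z`
at the expense of two steps for each vertex of `Z`. -/
theorem WalkFamily.exists_closed_walk {P Z : Set V} (hfin : Z.Finite) (hZ : Z.Nonempty)
    (hconn : (G.induce Z).Connected) (hZP : Z ⊆ P) {m : ℕ} {U : Set V}
    (h : WalkFamily G P Z m U) :
    ∃ (s : V) (C : G.Walk s s), (∀ x ∈ C.support, x ∈ P) ∧ C.length ≤ m + 2 * Z.ncard ∧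
      Z ⊆ {x | x ∈ C.support} ∧ U ⊆ {x | x ∈ C.support} := by
  suffices H : ∀ m U, WalkFamily G P Z m U →
      ∃ (s : V) (C : G.Walk s s), (∀ x ∈ C.support, x ∈ P) ∧ C.length ≤ m + 2 * Z.ncard ∧
        Z ⊆ {x | x ∈ C.support} ∧ U ⊆ {x | x ∈ C.support} from H m U h
  refine induction_of_connected_induce hfin hZ hconn (motive := fun S => ∀ m U,
    WalkFamily G P S m U →
      ∃ (s : V) (C : G.Walk s s), (∀ x ∈ C.support, x ∈ P) ∧ C.length ≤ m + 2 * S.ncard ∧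
        S ⊆ {x | x ∈ C.support} ∧ U ⊆ {x | x ∈ C.support}) ?_ ?_
  · intro v hv m U h
    rw [← insert_empty_eq] at h
    obtain ⟨w, p, n, W, hw, hp, hF, hn, hW⟩ := h.exists_walk_of_insert (hZP hv)
    obtain rfl : w = v := by simpa using hw
    rw [hF.eq_empty] at hW
    refine ⟨w, p, hp, by omega, by simp, fun x hx => by simpa using hW x hx⟩
  · intro S u v hSZ hu hv hvS huv ih m U h
    obtain ⟨w, p, n, W, hw, hp, hF, hn, hW⟩ := h.exists_walk_of_insert (hZP hv)
    have hcard := Set.ncard_insert_of_notMem hvS (hfin.subset hSZ)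
    have joined : ∀ (b : V) (q : G.Walk u b), b ∈ S → q.length ≤ p.length + 2 →
        (∀ x ∈ q.support, x = u ∨ x ∈ p.support) → (∀ x ∈ p.support, x ∈ q.support) →
        ∃ (s : V) (C : G.Walk s s), (∀ x ∈ C.support, x ∈ P) ∧
          C.length ≤ m + 2 * (insert v S).ncard ∧
          insert v S ⊆ {x | x ∈ C.support} ∧ U ⊆ {x | x ∈ C.support} := by
      intro b q hb hlen hqp hpq
      obtain ⟨s, C, hC, hClen, hSC, hUC⟩ := ih (q.length + n) {x | x ∈ q.support ∨ x ∈ W}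
        (.cons q hu hb (fun x hx => (hqp x hx).elim (fun h => h ▸ hZP (hSZ hu)) (hp x)) hF le_rfl
          fun x hx => hx)
      refine ⟨s, C, hC, by omega, ?_, ?_⟩
      · rintro x (rfl | hx)
        · exact hUC (Or.inl (hpq _ p.start_mem_support))
        · exact hSC hx
      · intro x hx
        exact hUC ((hW x hx).imp_left (hpq x))
    rcases hw with rfl | hw
    · refine joined u (.cons huv (p.append (.cons huv.symm .nil))) hu (by simp) ?_ ?_
      · intro x hx
        simp only [Walk.support_cons, List.mem_cons, Walk.mem_support_append_iff,
          Walk.support_nil, List.not_mem_nil, or_false] at hx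
        rcases hx with hx | hx | rfl | hx
        · exact .inl hx
        · exact .inr hx
        · exact .inr p.end_mem_support
        · exact .inl hx
      · intro x hx
        simp [Walk.mem_support_append_iff, hx]
    · exact joined w (.cons huv p) hw (by simp) (by simp) (by simp +contextual)

/-- If `P` and `Q` cover `G`, both contain `Z`, and are closed under stepping away from vertices
outside `Z`, then a walk ending in `Z` splits at its visits to `Z` into a family of walks in `P`,
a family of walks in `Q`, and an initial piece lying in `P` or in `Q`. -/
theorem SimpleGraph.Walk.exists_walkFamily {P Q Z : Set V} (hcover : ∀ v, v ∈ P ∨ v ∈ Q)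
    (hZP : Z ⊆ P) (hZQ : Z ⊆ Q)
    (hP : ∀ u v, G.Adj u v → v ∉ Z → v ∈ P → u ∈ P)
    (hQ : ∀ u v, G.Adj u v → v ∉ Z → v ∈ Q → u ∈ Q)
    {x y : V} (q : G.Walk x y) (hy : y ∈ Z) :
    ∃ (a : V) (p : G.Walk x a) (m n : ℕ) (U W : Set V), a ∈ Z ∧
      ((∀ v ∈ p.support, v ∈ P) ∨ ∀ v ∈ p.support, v ∈ Q) ∧
      WalkFamily G P Z m U ∧ WalkFamily G Q Z n W ∧ p.length + m + n ≤ q.length ∧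
      ∀ v ∈ q.support, v ∈ p.support ∨ v ∈ U ∨ v ∈ W := by
  induction q with
  | @nil x =>
    exact ⟨x, .nil, 0, 0, ∅, ∅, hy, .inl (by simpa using hZP hy), .nil, .nil, by simp, by simp⟩
  | @cons u x y hux q ih =>
    obtain ⟨a, p, m, n, U, W, ha, hp, hU, hW, hlen, hcov⟩ := ih hy
    by_cases hx : x ∈ Z
    · have hstep : (∀ v ∈ (Walk.cons hux .nil).support, v ∈ P) ∨
          ∀ v ∈ (Walk.cons hux .nil).support, v ∈ Q := by
        have h1 := hZP hx
        have h2 := hZQ hx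
        exact (hcover u).imp (by simp_all) (by simp_all)
      rcases hp with hp | hp
      · refine ⟨x, .cons hux .nil, p.length + m, n, {v | v ∈ p.support ∨ v ∈ U}, W, hx, hstep,
          .cons p hx ha hp hU le_rfl fun v hv => hv, hW, ?_, ?_⟩
        · simp only [Walk.length_cons, Walk.length_nil]; omega
        · intro v hv
          rw [Walk.support_cons, List.mem_cons] at hv
          have := hcov v
          simp only [Walk.support_cons, List.mem_cons, Set.mem_ofPred_eq]
          tauto
      · refine ⟨x, .cons hux .nil, m, p.length + n, U, {v | v ∈ p.support ∨ v ∈ W}, hx, hstep,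
          hU, .cons p hx ha hp hW le_rfl fun v hv => hv, ?_, ?_⟩
        · simp only [Walk.length_cons, Walk.length_nil]; omega
        · intro v hv
          rw [Walk.support_cons, List.mem_cons] at hv
          have := hcov v
          simp only [Walk.support_cons, List.mem_cons, Set.mem_ofPred_eq]
          tauto
    · refine ⟨a, .cons hux p, m, n, U, W, ha, ?_, hU, hW, ?_, ?_⟩
      · refine hp.imp (fun hp => ?_) (fun hp => ?_)
        · have := hP u x hux hx (hp x p.start_mem_support)
          simpa using ⟨this, hp⟩
        · have := hQ u x hux hx (hp x p.start_mem_support)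
          simpa using ⟨this, hp⟩
      · simp only [Walk.length_cons]; omega
      · intro v hv
        rw [Walk.support_cons, List.mem_cons] at hv
        rw [Walk.support_cons, List.mem_cons, or_assoc]
        exact hv.imp_right (hcov v)

/-- A family of walks in `P` with ends in a connected set `Z` that together with `Z` covers `P`
can be joined to a tour of `G[P]`. -/
theorem exists_isTour_induce {P Z U : Set V} (hfin : Z.Finite) (hZ : Z.Nonempty)
    (hconn : (G.induce Z).Connected) (hZP : Z ⊆ P) (hP : ∀ v ∈ P, v ∈ Z ∨ v ∈ U) {m : ℕ}
    (h : WalkFamily G P Z m U) :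
    ∃ (x : P) (C : (G.induce P).Walk x x), IsTour C ∧ C.length ≤ m + 2 * Z.ncard := by
  obtain ⟨s, C, hC, hlen, hZC, hUC⟩ := h.exists_closed_walk hfin hZ hconn hZP
  refine ⟨_, C.induce P hC, fun v => ?_, ?_⟩
  · rw [Walk.support_induce]
    simpa using (hP v v.2).elim (fun h => hZC h) (fun h => hUC h)
  · have := congrArg Walk.length (C.map_induce hC)
    rw [Walk.length_map] at this
    exact this.trans_le hlen

theorem mem_compUnion_union_of_adj {Z : Set V}
    (X : Set ((G.induce (Zᶜ : Set V)).ConnectedComponent)) {u v : V} (huv : G.Adj u v)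
    (hv : v ∉ Z) (hvX : v ∈ compUnion G Z X ∪ Z) : u ∈ compUnion G Z X ∪ Z := by
  by_cases hu : u ∈ Z
  · exact .inr hu
  · obtain ⟨hv', hX⟩ := hvX.resolve_right hv
    have hadj : (G.induce (Zᶜ : Set V)).Adj ⟨u, hu⟩ ⟨v, hv'⟩ := huv
    exact .inl ⟨hu, (ConnectedComponent.sound hadj.reachable) ▸ hX⟩

end

/-- Let `Z` be a nonempty vertex set of a finite graph `G` such that `G[Z]` is
connected, and partition the connected components of `G − Z` into two parts, with vertex unions
`A` and `B`. If `R` is a tour of `G`, then `G[A ∪ Z]` and `G[B ∪ Z]` have tours `R_A` and `R_B`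
respectively with `|R_A| + |R_B| ≤ |R| + 4·|Z|`. -/
theorem stmt_6 {V : Type*} [Fintype V] (G : SimpleGraph V)
    (Z : Set V) (hZ : Z.Nonempty) (hZconn : (G.induce Z).Connected)
    (X : Set ((G.induce (Zᶜ : Set V)).ConnectedComponent))
    (A B : Set V) (hA : A = compUnion G Z X) (hB : B = compUnion G Z Xᶜ)
    (w : V) (R : G.Walk w w) (hR : IsTour R) :
    ∃ (x : ↥(A ∪ Z)) (RA : (G.induce (A ∪ Z)).Walk x x)
      (y : ↥(B ∪ Z)) (RB : (G.induce (B ∪ Z)).Walk y y),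
      IsTour RA ∧ IsTour RB ∧ RA.length + RB.length ≤ R.length + 4 * Z.ncard := by
  classical
  subst hA hB
  obtain ⟨z, hz⟩ := id hZ
  have hcover : ∀ v, v ∈ compUnion G Z X ∪ Z ∨ v ∈ compUnion G Z Xᶜ ∪ Z := by
    intro v
    by_cases hv : v ∈ Z
    · exact .inl (.inr hv)
    · exact (em ((G.induce (Zᶜ : Set V)).connectedComponentMk ⟨v, hv⟩ ∈ X)).imp
        (fun h => .inl ⟨hv, h⟩) (fun h => .inl ⟨hv, h⟩)
  have hinter : ∀ v ∈ compUnion G Z X ∪ Z, v ∈ compUnion G Z Xᶜ ∪ Z → v ∈ Z := by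
    rintro v (⟨_, h⟩ | h) (⟨_, h'⟩ | h')
    · exact (h' h).elim
    all_goals assumption
  obtain ⟨a, p, m, n, U, W, ha, hp, hU, hW, hlen, hcov⟩ :=
    (R.rotate z (hR z)).exists_walkFamily hcover Set.subset_union_right
      Set.subset_union_right (fun _ _ => mem_compUnion_union_of_adj X)
      (fun _ _ => mem_compUnion_union_of_adj Xᶜ) hz
  rw [Walk.length_rotate] at hlen
  replace hcov : ∀ v, v ∈ p.support ∨ v ∈ U ∨ v ∈ W := fun v =>
    hcov v ((Walk.mem_support_rotate_iff R z (hR z)).2 (hR v))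
  obtain ⟨m, n, U, W, hU, hW, hlen, hcov⟩ : ∃ (m n : ℕ) (U W : Set V),
      WalkFamily G (compUnion G Z X ∪ Z) Z m U ∧ WalkFamily G (compUnion G Z Xᶜ ∪ Z) Z n W ∧
      m + n ≤ R.length ∧ ∀ v, v ∈ U ∨ v ∈ W := by
    rcases hp with hp | hp
    · exact ⟨p.length + m, n, {v | v ∈ p.support ∨ v ∈ U}, W,
        .cons p hz ha hp hU le_rfl fun v hv => hv, hW, hlen, fun v => or_assoc.2 (hcov v)⟩
    · exact ⟨m, p.length + n, U, {v | v ∈ p.support ∨ v ∈ W}, hU,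
        .cons p hz ha hp hW le_rfl fun v hv => hv, by omega, fun v => or_left_comm.1 (hcov v)⟩
  obtain ⟨x, RA, hRA, hlA⟩ := exists_isTour_induce Z.toFinite hZ hZconn Set.subset_union_right
    (fun v hv => (hcov v).symm.imp_left fun h => hinter v hv (hW.subset h)) hU
  obtain ⟨y, RB, hRB, hlB⟩ := exists_isTour_induce Z.toFinite hZ hZconn Set.subset_union_right
    (fun v hv => (hcov v).imp_left fun h => hinter v (hU.subset h) hv) hW
  exact ⟨x, RA, y, RB, hRA, hRB, by omega⟩
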